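/- Let 1 < q < 2 and χ > 0. Then |u| / |η_q(u; χ)|^{q−1} → χ·q as u → 0 with u ≠ 0. -/

import Mathlib

open Filter

/-- The proximal operator `η_q(u; χ)`, i.e. the (unique, for `q ≥ 1`, `χ > 0`) global
minimizer over `z ∈ ℝ` of `z ↦ (1/2)(u − z)² + χ|z|^q`. -/
noncomputable def prox (q χ u : ℝ) : ℝ :=
  Classical.epsilon fun z : ℝ =>
    ∀ w : ℝ, (1 / 2) * (u - z) ^ 2 + χ * |z| ^ q ≤ (1 / 2) * (u - w) ^ 2 + χ * |w| ^ q

/-- The proximal operator attains the global minimum of its objective. -/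
theorem prox_isMin {q χ : ℝ} (hq : 0 ≤ q) (hχ : 0 ≤ χ) (u w : ℝ) :
    (1 / 2) * (u - prox q χ u) ^ 2 + χ * |prox q χ u| ^ q ≤
      (1 / 2) * (u - w) ^ 2 + χ * |w| ^ q := by
  have hcont : Continuous fun z : ℝ => (1 / 2) * (u - z) ^ 2 + χ * |z| ^ q := by
    have : Continuous fun z : ℝ => |z| ^ q := continuous_abs.rpow_const fun _ => Or.inr hq
    fun_prop
  have hcoercive : Tendsto (fun z : ℝ => (1 / 2) * (u - z) ^ 2 + χ * |z| ^ q)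
      (cocompact ℝ) atTop := by
    refine tendsto_atTop_mono (f := fun z : ℝ => ‖z‖ + (-|u| - 1 / 2)) (fun z => ?_)
      (tendsto_atTop_add_const_right _ _ (tendsto_norm_cocompact_atTop (E := ℝ)))
    have h1 : 0 ≤ χ * |z| ^ q := by positivity
    have h2 : |z| ≤ |u| + |u - z| := by
      have := abs_sub_abs_le_abs_sub z u
      rw [abs_sub_comm] at this
      linarith
    have h3 : (u - z) ^ 2 = |u - z| ^ 2 := (sq_abs _).symm
    simp only [Real.norm_eq_abs]
    nlinarith [sq_nonneg (|u - z| - 1)]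
  exact Classical.epsilon_spec (hcont.exists_forall_le hcoercive) w

/-- The first-order optimality condition for the proximal operator. -/
theorem prox_stationary {q χ : ℝ} (hq : 1 < q) (hχ : 0 ≤ χ) (u : ℝ) :
    u = prox q χ u * (1 + χ * (q * |prox q χ u| ^ (q - 2))) := by
  have hmin : IsLocalMin (fun z : ℝ => (1 / 2) * (u - z) ^ 2 + χ * |z| ^ q) (prox q χ u) :=
    Eventually.of_forall (prox_isMin (by linarith) hχ u)
  have hderiv := ((((hasDerivAt_id (prox q χ u)).const_sub u).pow 2).const_mul (1 / 2)).add
    ((hasDerivAt_abs_rpow (prox q χ u) hq).const_mul χ)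
  have h := hmin.hasDerivAt_eq_zero hderiv
  simp only [id] at h
  norm_num at h
  linarith

theorem prox_ne_zero {q χ u : ℝ} (hq : 1 < q) (hχ : 0 ≤ χ) (hu : u ≠ 0) :
    prox q χ u ≠ 0 := by
  intro h
  have := prox_stationary hq hχ u
  rw [h, zero_mul] at this
  exact hu this

theorem abs_eq_abs_prox_mul {q χ : ℝ} (hq : 1 < q) (hχ : 0 ≤ χ) (u : ℝ) :
    |u| = |prox q χ u| * (1 + χ * (q * |prox q χ u| ^ (q - 2))) := by
  have hpos : 0 ≤ 1 + χ * (q * |prox q χ u| ^ (q - 2)) := by positivity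
  conv_lhs => rw [prox_stationary hq hχ u, abs_mul, abs_of_nonneg hpos]

theorem abs_prox_le {q χ : ℝ} (hq : 1 < q) (hχ : 0 ≤ χ) (u : ℝ) : |prox q χ u| ≤ |u| := by
  have hpos : 0 ≤ χ * (q * |prox q χ u| ^ (q - 2)) := by positivity
  rw [abs_eq_abs_prox_mul hq hχ u]
  exact le_mul_of_one_le_right (abs_nonneg _) (by linarith)

theorem abs_div_abs_prox_rpow {q χ u : ℝ} (hq : 1 < q) (hχ : 0 ≤ χ) (hu : u ≠ 0) :
    |u| / |prox q χ u| ^ (q - 1) = |prox q χ u| ^ (2 - q) + χ * q := by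
  have hz : 0 < |prox q χ u| := abs_pos.mpr (prox_ne_zero hq hχ hu)
  have h1 : |prox q χ u| ^ (q - 1) = |prox q χ u| * |prox q χ u| ^ (q - 2) := by
    rw [← Real.rpow_one_add' hz.le (by linarith)]
    ring_nf
  have h2 : |prox q χ u| ^ (2 - q) * |prox q χ u| ^ (q - 2) = 1 := by
    rw [← Real.rpow_add hz]
    simp
  rw [div_eq_iff (by positivity), abs_eq_abs_prox_mul hq hχ u, h1]
  linear_combination (-|prox q χ u|) * h2

/-- For `1 < q < 2` and `χ > 0`,
`|u| / |η_q(u; χ)|^{q−1} → χ·q` as `u → 0` with `u ≠ 0`. -/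
theorem stmt_5 (q χ : ℝ) (hq1 : 1 < q) (hq2 : q < 2) (hχ : 0 < χ) :
    Tendsto (fun u : ℝ => |u| / |prox q χ u| ^ (q - 1))
      (nhdsWithin 0 {(0 : ℝ)}ᶜ) (nhds (χ * q)) := by
  have habs : Tendsto (fun u : ℝ => |prox q χ u|) (nhds 0) (nhds 0) :=
    squeeze_zero (fun _ => abs_nonneg _) (abs_prox_le hq1 hχ.le)
      (by simpa using (continuous_abs (G := ℝ)).tendsto 0)
  have hpow : Tendsto (fun u : ℝ => |prox q χ u| ^ (2 - q) + χ * q) (nhds 0) (nhds (χ * q)) := by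
    have := (habs.rpow_const (p := 2 - q) (Or.inr (by linarith))).add_const (χ * q)
    rwa [Real.zero_rpow (by linarith), zero_add] at this
  refine (hpow.mono_left nhdsWithin_le_nhds).congr' ?_
  filter_upwards [self_mem_nhdsWithin] with u hu
  exact (abs_div_abs_prox_rpow hq1 hχ.le hu).symm
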